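/- There exists a topological space X in which the inclusion σ ⊆ τ_ω is strict: namely, in X = {a} ∪ ℝ (a ∉ ℝ) with the topology generated by the base {{a}} ∪ {{a, r} : r ∈ ℝ}, the set {a} is ω-open but does not belong to σ. -/

import Mathlib

open Set TopologicalSpace

/-- Local closure function w.r.t. the ideal of countable sets:
`Γ(A) = {x : Cl(U) ∩ A is uncountable for every open neighborhood U of x}`. -/
def Gamma (X : Type*) [TopologicalSpace X] (A : Set X) : Set X :=
  {x | ∀ U : Set X, IsOpen U → x ∈ U → ¬ (closure U ∩ A).Countable}

/-- Membership in the topology `σ`: `A ∈ σ ↔ Γ(X \ A) ⊆ X \ A`. -/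
def memSigma (X : Type*) [TopologicalSpace X] (A : Set X) : Prop :=
  Gamma X Aᶜ ⊆ Aᶜ

/-- `A` is ω-open if every point of `A` has an open neighborhood `U`
with `U \ A` countable. -/
def IsOmegaOpen (X : Type*) [TopologicalSpace X] (A : Set X) : Prop :=
  ∀ x ∈ A, ∃ U : Set X, IsOpen U ∧ x ∈ U ∧ (U \ A).Countable

/-- The space `X = {a} ∪ ℝ` (with `a ∉ ℝ`) modelled as `Option ℝ`, where `a = none`
and each real `r` is `some r`, with the topology generated by the base
`{{a}} ∪ {{a, r} : r ∈ ℝ}`. -/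
def tauX : TopologicalSpace (Option ℝ) :=
  TopologicalSpace.generateFrom
    (insert {none} {s : Set (Option ℝ) | ∃ r : ℝ, s = {none, some r}})

/-- The point `a = none` lies in every nonempty open set of `tauX`. -/
theorem none_mem_of_isOpen_tauX {U : Set (Option ℝ)} (hU : @IsOpen _ tauX U) (hne : U.Nonempty) :
    none ∈ U := by
  induction hU with
  | basic s hs =>
    rcases hs with rfl | ⟨r, rfl⟩ <;> simp
  | univ => trivial
  | inter s t _ _ ihs iht => exact ⟨ihs hne.left, iht hne.right⟩
  | sUnion S _ ih =>
    obtain ⟨x, s, hs, hx⟩ := hne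
    exact ⟨s, hs, ih s hs ⟨x, hx⟩⟩

/-- Every nonempty open set of `tauX` is dense. -/
theorem closure_eq_univ_of_isOpen_tauX {U : Set (Option ℝ)} (hU : @IsOpen _ tauX U)
    (hne : U.Nonempty) : @closure _ tauX U = univ := by
  let := tauX
  exact Dense.closure_eq <| dense_iff_inter_open.2 fun _ hV hVne =>
    ⟨none, none_mem_of_isOpen_tauX hV hVne, none_mem_of_isOpen_tauX hU hne⟩

theorem not_countable_compl_none : ¬ ({none}ᶜ : Set (Option ℝ)).Countable := fun h =>
  Cardinal.not_countable_real <|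
    (h.preimage (Option.some_injective ℝ)).mono fun _ _ => Option.some_ne_none _

/-- The inclusion `σ ⊆ τ_ω` can be strict: in the space `X = {a} ∪ ℝ` with the
base `{{a}} ∪ {{a,r} : r ∈ ℝ}`, the set `{a}` is ω-open but not in `σ`. -/
theorem sigma_strictly_smaller_than_omegaOpen :
    @IsOmegaOpen (Option ℝ) tauX {none} ∧ ¬ @memSigma (Option ℝ) tauX {none} := by
  let := tauX
  refine ⟨fun x hx => ⟨{none}, .basic _ (mem_insert _ _), hx, by simp⟩, fun h => ?_⟩
  have hmem : none ∈ Gamma (Option ℝ) {none}ᶜ := fun U hU hxU => by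
    rw [closure_eq_univ_of_isOpen_tauX hU ⟨none, hxU⟩, univ_inter]
    exact not_countable_compl_none
  exact h hmem rfl
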